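/- In any orthomodular lattice, φ_a(c) = φ_b(c) if and only if φ_{a'}(c) = φ_{b'}(c), where φ_a(b) := a ∩ (a' ∪ b). Moreover, an ortholattice in which this equivalence holds for all a, b, c is orthomodular. -/

import Mathlib

theorem sasaki_aux {α : Type*} [Lattice α] [BoundedOrder α] (o : α → α)
    (h1 : ∀ a : α, o (o a) = a) (h2 : ∀ a b : α, a ≤ b → o b ≤ o a)
    (h4 : ∀ a : α, a ⊓ o a = ⊥)
    (h5 : ∀ a b : α, a ≤ b → b = a ⊔ (o a ⊓ b)) (a c : α) :
    o a ⊓ (a ⊔ c) = o (a ⊓ (o a ⊔ c)) ⊓ ((a ⊓ (o a ⊔ c)) ⊔ c) := by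
  have h2' : ∀ a b : α, a ≤ o b → b ≤ o a := fun a b h => by
    have := h2 _ _ h; rwa [h1] at this
  have key : ∀ z, z ≤ o (a ⊓ (o a ⊔ c)) → z ≤ o a ⊔ c → z ≤ o a := by
    intro z hz1 hz2
    have hs := h5 (o (o a ⊔ c)) a (by
      have := h2 _ _ (le_sup_left : o a ≤ o a ⊔ c); rwa [h1] at this)
    rw [h1, inf_comm] at hs
    apply h2'
    rw [hs]
    exact sup_le (h2 _ _ hz2) (h2' _ _ hz1)
  apply le_antisymm
  · refine le_inf (inf_le_left.trans (h2 _ _ inf_le_left)) ?_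
    set t := (a ⊓ (o a ⊔ c)) ⊔ c with ht
    have htw : t ≤ (a ⊔ c) ⊓ (o a ⊔ c) :=
      sup_le (le_inf (inf_le_left.trans le_sup_left) inf_le_right)
        (le_inf le_sup_right le_sup_right)
    have e := h5 _ _ htw
    have hz : o t ⊓ ((a ⊔ c) ⊓ (o a ⊔ c)) ≤ ⊥ := by
      have k1 : o t ⊓ ((a ⊔ c) ⊓ (o a ⊔ c)) ≤ o a :=
        key _ (inf_le_left.trans (h2 _ _ le_sup_left)) (inf_le_right.trans inf_le_right)
      have k2 : o t ⊓ ((a ⊔ c) ⊓ (o a ⊔ c)) ≤ o c :=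
        inf_le_left.trans (h2 _ _ le_sup_right)
      have k3 : a ⊔ c ≤ o (o t ⊓ ((a ⊔ c) ⊓ (o a ⊔ c))) := sup_le (h2' _ _ k1) (h2' _ _ k2)
      have k4 := (inf_le_right.trans inf_le_left : o t ⊓ ((a ⊔ c) ⊓ (o a ⊔ c)) ≤ a ⊔ c).trans k3
      exact (le_inf le_rfl k4).trans (h4 _).le
    rw [le_bot_iff.mp hz, sup_bot_eq] at e
    rw [← e]
    exact le_inf inf_le_right (inf_le_left.trans le_sup_left)
  · refine le_inf (key _ inf_le_left (inf_le_right.trans (sup_le inf_le_right le_sup_right)))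
      (inf_le_right.trans (sup_le (inf_le_left.trans le_sup_left) le_sup_right))

/-- In any OML, `φ_a(c) = φ_b(c) ↔ φ_{a'}(c) = φ_{b'}(c)`; conversely any
ortholattice satisfying this equivalence is orthomodular. -/
theorem sasaki_proj_compl_iff :
    (∀ (α : Type*) [Lattice α] [BoundedOrder α] (o : α → α),
      (∀ a : α, o (o a) = a) →
      (∀ a b : α, a ≤ b → o b ≤ o a) →
      (∀ a : α, a ⊔ o a = ⊤) →
      (∀ a : α, a ⊓ o a = ⊥) →
      (∀ a b : α, a ≤ b → b = a ⊔ (o a ⊓ b)) →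
      ∀ a b d : α,
        a ⊓ (o a ⊔ d) = b ⊓ (o b ⊔ d) ↔ o a ⊓ (o (o a) ⊔ d) = o b ⊓ (o (o b) ⊔ d)) ∧
    (∀ (α : Type*) [Lattice α] [BoundedOrder α] (o : α → α),
      (∀ a : α, o (o a) = a) →
      (∀ a b : α, a ≤ b → o b ≤ o a) →
      (∀ a : α, a ⊔ o a = ⊤) →
      (∀ a : α, a ⊓ o a = ⊥) →
      (∀ a b d : α,
        a ⊓ (o a ⊔ d) = b ⊓ (o b ⊔ d) ↔ o a ⊓ (o (o a) ⊔ d) = o b ⊓ (o (o b) ⊔ d)) →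
      ∀ a b : α, a ≤ b → b = a ⊔ (o a ⊓ b)) := by
  constructor
  · intro α _ _ o h1 h2 h3 h4 h5
    have imp : ∀ a b d : α, a ⊓ (o a ⊔ d) = b ⊓ (o b ⊔ d) →
        o a ⊓ (o (o a) ⊔ d) = o b ⊓ (o (o b) ⊔ d) := by
      intro a b d h
      rw [h1, h1, sasaki_aux o h1 h2 h4 h5 a d, sasaki_aux o h1 h2 h4 h5 b d, h]
    intro a b d
    refine ⟨imp a b d, fun h => ?_⟩
    have := imp _ _ _ h
    simpa only [h1] using this
  · intro α _ _ o h1 h2 h3 h4 H a b hab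
    set u := a ⊔ (o a ⊓ b) with hu
    have hub : u ≤ b := sup_le hab inf_le_right
    have h := (H u b u).mpr (by
      rw [h1, h1, sup_idem, sup_eq_left.mpr hub, inf_comm, h4, inf_comm, h4])
    have hbot : o (o b ⊔ u) ≤ ⊥ := by
      have k1 : o (o b ⊔ u) ≤ b := by
        have := h2 _ _ (le_sup_left : o b ≤ o b ⊔ u); rwa [h1] at this
      have k2 : o (o b ⊔ u) ≤ o u := h2 _ _ le_sup_right
      have k3 : o (o b ⊔ u) ≤ o a := k2.trans (h2 _ _ le_sup_left)
      have k4 : o (o b ⊔ u) ≤ u := (le_inf k3 k1).trans le_sup_right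
      exact (le_inf k4 k2).trans (h4 _).le
    have htop : o b ⊔ u = ⊤ := by
      have := h3 (o b ⊔ u)
      rwa [le_bot_iff.mp hbot, sup_bot_eq] at this
    rw [htop, inf_top_eq, sup_comm, h3, inf_top_eq] at h
    exact h.symm
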